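/- Let p ≥ 5 be a prime, q a power of p, and u ≥ 1 a positive integer. Then (q^{pu} − 1)/φ(q^{pu} − 1) < 3.6 · log q + 1.8 · log u, where log denotes the natural logarithm. -/

import Mathlib

open Real Filter Topology Chebyshev
open scoped Nat

theorem Nat.prime_iff_of_lt_sq_fortySeven {k : ℕ} (hk : k < 47 ^ 2) :
    k.Prime ↔ k ∈ [2, 3, 5, 7, 11, 13, 17, 19, 23, 29, 31, 37, 41, 43] ∨
      (1 < k ∧ Nat.gcd k 13082761331670030 = 1) := by
  have hQ : 13082761331670030 = [2, 3, 5, 7, 11, 13, 17, 19, 23, 29, 31, 37, 41, 43].prod := by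
    norm_num
  have hS : ∀ r : ℕ, r.Prime → r < 47 →
      r ∈ [2, 3, 5, 7, 11, 13, 17, 19, 23, 29, 31, 37, 41, 43] := by
    intro r hr h
    interval_cases r <;> first | simp; done | norm_num at hr
  have hS' : ∀ r ∈ [2, 3, 5, 7, 11, 13, 17, 19, 23, 29, 31, 37, 41, 43], Nat.Prime r := by
    intro r hr
    fin_cases hr <;> norm_num
  constructor
  · intro h
    by_cases h47 : k < 47
    · exact Or.inl (hS k h h47)
    refine Or.inr ⟨h.one_lt, ?_⟩
    rw [hQ]
    refine Nat.coprime_list_prod_right_iff.2 fun r hr ↦ ?_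
    refine (Nat.coprime_primes h (hS' r hr)).2 ?_
    rintro rfl
    simp only [List.mem_cons, List.not_mem_nil, or_false] at hr
    omega
  · rintro (h | ⟨h1, h⟩)
    · exact hS' k h
    by_contra hp
    have hm := Nat.minFac_prime h1.ne'
    have hlt : k.minFac < 47 := by
      have := Nat.minFac_sq_le_self (by omega) hp
      nlinarith
    have hd : k.minFac ∣ Nat.gcd k 13082761331670030 :=
      Nat.dvd_gcd (Nat.minFac_dvd k) (hQ ▸ List.dvd_prod (hS _ hm hlt))
    rw [h] at hd
    exact hm.one_lt.ne' (Nat.dvd_one.1 hd)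

theorem Nat.primesLE_eq_filter_gcd {n : ℕ} (hn : n < 47 ^ 2) :
    n.primesLE = (Finset.range (n + 1)).filter fun k ↦
      k ∈ [2, 3, 5, 7, 11, 13, 17, 19, 23, 29, 31, 37, 41, 43] ∨
      (1 < k ∧ Nat.gcd k 13082761331670030 = 1) := by
  rw [Nat.primesLE_eq_filter_range]
  refine Finset.filter_congr fun k hk ↦ Nat.prime_iff_of_lt_sq_fortySeven ?_
  have := Finset.mem_range.1 hk
  omega

theorem log_div_totient_eq_sum_primeFactors {N : ℕ} (hN : N ≠ 0) :
    log (N / N.totient) = ∑ r ∈ N.primeFactors, -log (1 - 1 / (r : ℝ)) := by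
  have h : (N.totient : ℝ) = N * ∏ r ∈ N.primeFactors, (1 - (r : ℝ)⁻¹) := by
    have := congrArg (Rat.cast : ℚ → ℝ) (Nat.totient_eq_mul_prod_factors N)
    push_cast at this
    exact this
  have hN' : (N : ℝ) ≠ 0 := by exact_mod_cast hN
  have hr : ∀ r ∈ N.primeFactors, (1 - (r : ℝ)⁻¹) ≠ 0 := by
    intro r hr
    have : (1 : ℝ) < r := by exact_mod_cast (Nat.prime_of_mem_primeFactors hr).one_lt
    have := inv_lt_one_of_one_lt₀ this
    linarith
  rw [h, div_mul_cancel_left₀ hN', log_inv, log_prod hr, ← Finset.sum_neg_distrib]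
  simp

theorem one_div_le_neg_log_one_sub {r : ℝ} (hr : 1 < r) : 1 / r ≤ -log (1 - 1 / r) := by
  have h : 0 < 1 - 1 / r := by
    rw [sub_pos, div_lt_one (by linarith)]
    exact hr
  have := log_le_sub_one_of_pos h
  linarith

theorem neg_log_one_sub_le {r : ℝ} (hr : 1 < r) : -log (1 - 1 / r) ≤ 1 / (r - 1) := by
  have h0 : 0 < r - 1 := by linarith
  have h : 0 < 1 - 1 / r := by
    rw [sub_pos, div_lt_one (by linarith)]
    exact hr
  have := log_le_sub_one_of_pos (inv_pos.2 h)
  rw [log_inv] at this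
  refine this.trans_eq ?_
  field_simp
  ring

theorem sum_log_primeFactors_le {N : ℕ} (hN : N ≠ 0) :
    ∑ r ∈ N.primeFactors, log r ≤ log N := by
  rw [← log_prod fun r hr ↦ by exact_mod_cast (Nat.prime_of_mem_primeFactors hr).ne_zero]
  refine log_le_log ?_ ?_
  · exact Finset.prod_pos fun r hr ↦ by exact_mod_cast (Nat.prime_of_mem_primeFactors hr).pos
  · rw [← Nat.cast_prod]
    exact_mod_cast Nat.le_of_dvd (Nat.pos_of_ne_zero hN) (Nat.prod_primeFactors_dvd N)

/-- The primes up to `n` maximize `N / φ(N)`, up to a linear correction in `log N - θ(n)`. -/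
theorem log_div_totient_le {N n : ℕ} (hN : N ≠ 0) (hn : 2 ≤ n) :
    log (N / N.totient) ≤
      ∑ r ∈ n.primesLE, -log (1 - 1 / (r : ℝ)) + (log N - θ n) / (n * log n) := by
  have hn' : (2 : ℝ) ≤ n := by exact_mod_cast hn
  have hL : 0 < log n := log_pos (by linarith)
  set c : ℝ := 1 / (n * log n) with hc
  have hc0 : 0 ≤ c := by positivity
  set f : ℕ → ℝ := fun r ↦ -log (1 - 1 / (r : ℝ)) - c * log r with hf
  have hle : ∀ r : ℕ, r.Prime → r ≤ n → 0 ≤ f r := by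
    intro r hr hrn
    have h1 : (1 : ℝ) < r := by exact_mod_cast hr.one_lt
    have h2 : (r : ℝ) ≤ n := by exact_mod_cast hrn
    have h3 := one_div_le_neg_log_one_sub h1
    have h4 : c * log r ≤ 1 / r := by
      calc c * log r ≤ c * log n := by gcongr
        _ = 1 / n := by rw [hc]; field_simp
        _ ≤ 1 / r := by gcongr
    simp only [hf]
    linarith
  have hgt : ∀ r : ℕ, r.Prime → n < r → f r ≤ 0 := by
    intro r hr hrn
    have h1 : (1 : ℝ) < r := by exact_mod_cast hr.one_lt
    have h2 : (n : ℝ) + 1 ≤ r := by exact_mod_cast hrn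
    have h3 := neg_log_one_sub_le h1
    have h4 : 1 / ((r : ℝ) - 1) ≤ c * log r := by
      calc 1 / ((r : ℝ) - 1) ≤ 1 / n := by gcongr; linarith
        _ = c * log n := by rw [hc]; field_simp
        _ ≤ c * log r := by gcongr
    simp only [hf]
    linarith
  have hsum : ∑ r ∈ N.primeFactors, f r ≤ ∑ r ∈ n.primesLE, f r := by
    calc ∑ r ∈ N.primeFactors, f r
        ≤ ∑ r ∈ N.primeFactors.filter (· ≤ n), f r := by
          rw [← Finset.sum_filter_add_sum_filter_not N.primeFactors (· ≤ n)]
          have : ∑ r ∈ N.primeFactors.filter (¬ · ≤ n), f r ≤ 0 := by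
            refine Finset.sum_nonpos fun r hr ↦ ?_
            rw [Finset.mem_filter] at hr
            exact hgt r (Nat.prime_of_mem_primeFactors hr.1) (not_le.1 hr.2)
          linarith
      _ ≤ ∑ r ∈ n.primesLE, f r := by
          refine Finset.sum_le_sum_of_subset_of_nonneg ?_ ?_
          · intro r hr
            rw [Finset.mem_filter] at hr
            exact Nat.mem_primesLE.2 ⟨hr.2, Nat.prime_of_mem_primeFactors hr.1⟩
          · intro r hr _
            exact hle r (Nat.prime_of_mem_primesLE hr) (Nat.le_of_mem_primesLE hr)
  simp only [hf, Finset.sum_sub_distrib, ← Finset.mul_sum] at hsum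
  have h5 := mul_le_mul_of_nonneg_left (sum_log_primeFactors_le hN) hc0
  rw [log_div_totient_eq_sum_primeFactors hN, theta_eq_sum_primesLE_log, div_eq_mul_one_div, ← hc]
  linarith

theorem div_totient_le_of_log_le_theta {N n : ℕ} (hN : N ≠ 0) (hn : 2 ≤ n) (h : log N ≤ θ n) :
    (N / N.totient : ℝ) ≤ (∏ r ∈ n.primesLE, (r : ℝ)) / ∏ r ∈ n.primesLE, ((r : ℝ) - 1) := by
  have h1 := log_div_totient_le hN hn
  have h2 : (log N - θ n) / (n * log n) ≤ 0 :=
    div_nonpos_of_nonpos_of_nonneg (by linarith) (by positivity)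
  have hpos : (0 : ℝ) < N / N.totient := by
    have := Nat.totient_pos.2 (Nat.pos_of_ne_zero hN)
    positivity
  have h1r : ∀ r ∈ n.primesLE, (1 : ℝ) < r := fun r hr ↦ by
    exact_mod_cast Nat.one_lt_of_mem_primesLE hr
  have hP : 0 < ∏ r ∈ n.primesLE, (r : ℝ) / ((r : ℝ) - 1) :=
    Finset.prod_pos fun r hr ↦ by
      have := h1r r hr
      exact div_pos (by linarith) (by linarith)
  rw [← Finset.prod_div_distrib]
  refine (log_le_log_iff hpos hP).1 ?_
  rw [log_prod fun r hr ↦ ?_]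
  · have : ∀ r ∈ n.primesLE, log ((r : ℝ) / (r - 1)) = -log (1 - 1 / (r : ℝ)) := by
      intro r hr
      have := h1r r hr
      rw [← log_inv]
      congr 1
      field_simp
    rw [Finset.sum_congr rfl this]
    linarith
  · have := h1r r hr
    exact (div_pos (by linarith) (by linarith)).ne'

theorem rpow_neg_one_add_le_sub {δ : ℝ} (hδ : 0 < δ) {k : ℕ} (hk : 1 ≤ k) :
    ((k + 1 : ℕ) : ℝ) ^ (-(1 + δ)) ≤ 1 / δ * ((k : ℝ) ^ (-δ) - ((k + 1 : ℕ) : ℝ) ^ (-δ)) := by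
  have hk' : (0 : ℝ) < k := by exact_mod_cast hk
  have hk1 : (0 : ℝ) < (k : ℝ) + 1 := by positivity
  push_cast
  have h1 : (1 + δ * (1 / ((k : ℝ) + 1))) * ((k : ℝ) + 1) ^ (-δ) ≤ (k : ℝ) ^ (-δ) := by
    rw [rpow_def_of_pos hk', rpow_def_of_pos hk1]
    have h2 : 1 / ((k : ℝ) + 1) ≤ log ((k : ℝ) + 1) - log k := by
      rw [← log_div (by positivity) (by positivity)]
      refine le_trans (le_of_eq ?_) (one_sub_inv_le_log_of_pos (by positivity))
      field_simp
      ring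
    calc (1 + δ * (1 / ((k : ℝ) + 1))) * exp (log ((k : ℝ) + 1) * -δ)
        ≤ exp (δ * (1 / ((k : ℝ) + 1))) * exp (log ((k : ℝ) + 1) * -δ) := by
          gcongr
          linarith [add_one_le_exp (δ * (1 / ((k : ℝ) + 1)))]
      _ = exp (δ * (1 / ((k : ℝ) + 1)) + log ((k : ℝ) + 1) * -δ) := (exp_add _ _).symm
      _ ≤ exp (log k * -δ) := by
          rw [exp_le_exp]
          nlinarith [mul_le_mul_of_nonneg_left h2 hδ.le]
  have h3 : ((k : ℝ) + 1) ^ (-(1 + δ)) = ((k : ℝ) + 1) ^ (-δ) / (k + 1) := by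
    rw [show -(1 + δ) = -δ - 1 by ring, rpow_sub_one hk1.ne']
  rw [h3, one_div, inv_mul_eq_div, le_div_iff₀ hδ]
  have h4 : δ * (1 / ((k : ℝ) + 1)) * ((k : ℝ) + 1) ^ (-δ) =
      ((k : ℝ) + 1) ^ (-δ) / (k + 1) * δ := by ring
  linarith

theorem tsum_rpow_neg_one_add_le {δ : ℝ} (hδ : 0 < δ) :
    ∑' k : ℕ, (k : ℝ) ^ (-(1 + δ)) ≤ 1 + 1 / δ := by
  have hsum : ∀ M : ℕ, ∑ k ∈ Finset.range (M + 2), (k : ℝ) ^ (-(1 + δ)) ≤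
      1 + 1 / δ - 1 / δ * ((M + 1 : ℕ) : ℝ) ^ (-δ) := by
    intro M
    induction M with
    | zero => simp [Finset.sum_range_succ, zero_rpow (by linarith : -δ + -1 ≠ 0)]
    | succ M ih =>
      rw [Finset.sum_range_succ]
      have := rpow_neg_one_add_le_sub hδ (k := M + 1) (by omega)
      linarith
  refine Real.tsum_le_of_sum_range_le (fun k ↦ by positivity) fun M ↦ ?_
  calc ∑ k ∈ Finset.range M, (k : ℝ) ^ (-(1 + δ))
      ≤ ∑ k ∈ Finset.range (M + 2), (k : ℝ) ^ (-(1 + δ)) :=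
        Finset.sum_le_sum_of_subset_of_nonneg (Finset.range_mono (by omega))
          fun _ _ _ ↦ by positivity
    _ ≤ 1 + 1 / δ := by
        have : 0 ≤ 1 / δ * ((M + 1 : ℕ) : ℝ) ^ (-δ) := by positivity
        linarith [hsum M]

theorem natCast_rpow_neg_lt_one {s : ℝ} (hs : 0 < s) {r : ℕ} (hr : r.Prime) :
    (r : ℝ) ^ (-s) < 1 :=
  rpow_lt_one_of_one_lt_of_neg (by exact_mod_cast hr.one_lt) (by linarith)

theorem sum_primesLE_neg_log_one_sub_rpow_le {δ : ℝ} (hδ : 0 < δ) (T : ℕ) :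
    ∑ r ∈ T.primesLE, -log (1 - (r : ℝ) ^ (-(1 + δ))) ≤ log (1 + 1 / δ) := by
  let f : ℕ →* ℝ :=
    { toFun := fun k ↦ (k : ℝ) ^ (-(1 + δ))
      map_one' := by simp
      map_mul' := fun a b ↦ by
        push_cast
        exact mul_rpow (by positivity) (by positivity) }
  have hf : Summable f := by
    change Summable fun k : ℕ ↦ (k : ℝ) ^ (-(1 + δ))
    exact Real.summable_nat_rpow.2 (by linarith)
  have h := EulerProduct.prod_primesBelow_geometric_eq_tsum_smoothNumbers hf (T + 1)
  have h1 : ∏ r ∈ T.primesLE, (1 - (r : ℝ) ^ (-(1 + δ)))⁻¹ ≤ 1 + 1 / δ := by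
    refine (le_of_eq h).trans ((hf.tsum_subtype_le f _ fun k ↦ ?_).trans
      (tsum_rpow_neg_one_add_le hδ))
    change 0 ≤ (k : ℝ) ^ (-(1 + δ))
    positivity
  have hpos : ∀ r ∈ T.primesLE, 0 < 1 - (r : ℝ) ^ (-(1 + δ)) := fun r hr ↦ by
    have := natCast_rpow_neg_lt_one (s := 1 + δ) (by linarith) (Nat.prime_of_mem_primesLE hr)
    linarith
  have h2 := log_le_log (Finset.prod_pos fun r hr ↦ inv_pos.2 (hpos r hr)) h1
  rw [log_prod fun r hr ↦ (inv_pos.2 (hpos r hr)).ne'] at h2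
  simpa only [log_inv] using h2

theorem neg_mul_le_sum_Ioc_mul_of_antitoneOn {c g : ℕ → ℝ} {n : ℕ} {K : ℝ}
    (hg : AntitoneOn g (Set.Ici n))
    (hc : ∀ k, n ≤ k → -K ≤ ∑ j ∈ Finset.Ioc n k, c j) {T : ℕ} (hT : n ≤ T)
    (hgT : 0 ≤ g T) : -(K * g n) ≤ ∑ j ∈ Finset.Ioc n T, c j * g j := by
  have key : g T * (∑ j ∈ Finset.Ioc n T, c j + K) - K * g n ≤
      ∑ j ∈ Finset.Ioc n T, c j * g j := by
    clear hgT
    induction T, hT using Nat.le_induction with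
    | base => simp [mul_comm]
    | succ T hT ih =>
      rw [Finset.sum_Ioc_succ_top (by omega), Finset.sum_Ioc_succ_top (by omega)]
      have h1 : g (T + 1) ≤ g T := hg hT (by simp; omega) (by omega)
      have h2 : 0 ≤ ∑ j ∈ Finset.Ioc n T, c j + K := by linarith [hc T hT]
      nlinarith [mul_le_mul_of_nonneg_right h1 h2]
  have : 0 ≤ g T * (∑ j ∈ Finset.Ioc n T, c j + K) :=
    mul_nonneg hgT (by linarith [hc T hT])
  linarith

theorem antitoneOn_exp_neg_mul_div {δ : ℝ} (hδ : 0 ≤ δ) :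
    AntitoneOn (fun v : ℝ ↦ exp (-(δ * v)) / v) (Set.Ioi 0) := by
  intro x hx y hy hxy
  have hx' : 0 < x := hx
  dsimp only
  gcongr

theorem intervalIntegrable_exp_neg_mul_div {δ a b : ℝ} (ha : 0 < a) (hb : 0 < b) :
    IntervalIntegrable (fun v : ℝ ↦ exp (-(δ * v)) / v) MeasureTheory.volume a b := by
  refine ContinuousOn.intervalIntegrable ?_
  refine ContinuousOn.div (by fun_prop) continuousOn_id fun x hx ↦ ?_
  have : 0 < x := lt_of_lt_of_le (lt_min ha hb) hx.1
  exact this.ne'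

theorem integral_le_mul_of_antitoneOn {h : ℝ → ℝ} {a b : ℝ} (hab : a ≤ b)
    (hh : AntitoneOn h (Set.Icc a b)) : ∫ v in a..b, h v ≤ (b - a) * h a := by
  calc ∫ v in a..b, h v ≤ ∫ _ in a..b, h a := by
        refine intervalIntegral.integral_mono_on hab ?_ (by simp) fun x hx ↦
          hh (Set.left_mem_Icc.2 hab) hx hx.1
        exact AntitoneOn.intervalIntegrable (by rwa [Set.uIcc_of_le hab])
    _ = (b - a) * h a := by simp

theorem mul_le_integral_of_antitoneOn {h : ℝ → ℝ} {a b : ℝ} (hab : a ≤ b)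
    (hh : AntitoneOn h (Set.Icc a b)) : (b - a) * h b ≤ ∫ v in a..b, h v := by
  calc (b - a) * h b = ∫ _ in a..b, h b := by simp
    _ ≤ ∫ v in a..b, h v := by
        refine intervalIntegral.integral_mono_on hab (by simp) ?_ fun x hx ↦
          hh hx (Set.right_mem_Icc.2 hab) hx.2
        exact AntitoneOn.intervalIntegrable (by rwa [Set.uIcc_of_le hab])

theorem integral_le_sum_Ioc_log_succ_sub_log {δ : ℝ} (hδ : 0 ≤ δ) {n T : ℕ} (hn : 1 ≤ n)
    (hT : n ≤ T) :
    ∫ v in log (n + 1)..log (T + 1), exp (-(δ * v)) / v ≤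
      ∑ j ∈ Finset.Ioc n T, (log (j + 1) - log j) * (exp (-(δ * log j)) / log j) := by
  induction T, hT using Nat.le_induction with
  | base => simp
  | succ T hT ih =>
    have hn' : (1 : ℝ) ≤ n := by exact_mod_cast hn
    have hT' : (n : ℝ) ≤ T := by exact_mod_cast hT
    have h0 : 0 < log ((n : ℝ) + 1) := log_pos (by linarith)
    have h1 : 0 < log ((T : ℝ) + 1) := log_pos (by linarith)
    have h2 : log ((T : ℝ) + 1) ≤ log ((T : ℝ) + 1 + 1) := log_le_log (by linarith) (by linarith)
    rw [Finset.sum_Ioc_succ_top (by omega)]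
    push_cast
    rw [← intervalIntegral.integral_add_adjacent_intervals
      (intervalIntegrable_exp_neg_mul_div h0 h1)
      (intervalIntegrable_exp_neg_mul_div h1 (h1.trans_le h2))]
    refine add_le_add ih (integral_le_mul_of_antitoneOn h2 ?_)
    exact (antitoneOn_exp_neg_mul_div hδ).mono fun x hx ↦ h1.trans_le hx.1

theorem add_sum_Ioc_le_integral {δ a : ℝ} (hδ : 0 ≤ δ) (ha : 0 < a) {A J : ℕ} (hA : a ≤ A)
    (hJ : A ≤ J) :
    exp (-(δ * A)) * (log A - log a) + ∑ k ∈ Finset.Ioc A J, exp (-(δ * k)) / k ≤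
      ∫ v in a..J, exp (-(δ * v)) / v := by
  induction J, hJ using Nat.le_induction with
  | base =>
    have hA' := ha.trans_le hA
    have h1 : ∫ v in a..A, exp (-(δ * A)) * v⁻¹ = exp (-(δ * A)) * (log A - log a) := by
      rw [intervalIntegral.integral_const_mul, integral_inv_of_pos ha hA',
        log_div hA'.ne' ha.ne']
    rw [Finset.Ioc_self, Finset.sum_empty, add_zero, ← h1]
    refine intervalIntegral.integral_mono_on hA ?_ (intervalIntegrable_exp_neg_mul_div ha hA') ?_
    · refine (intervalIntegral.intervalIntegrable_inv (fun x hx ↦ ?_) continuousOn_id).const_mul _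
      rw [Set.uIcc_of_le hA] at hx
      exact (ha.trans_le hx.1).ne'
    · intro x hx
      have hx0 : 0 < x := ha.trans_le hx.1
      rw [div_eq_mul_inv]
      gcongr
      exact hx.2
  | succ J hJ ih =>
    have hJ' : (A : ℝ) ≤ J := by exact_mod_cast hJ
    have h0 : (0 : ℝ) < J := by linarith
    rw [Finset.sum_Ioc_succ_top (by omega),
      ← intervalIntegral.integral_add_adjacent_intervals
        (intervalIntegrable_exp_neg_mul_div ha h0)
        (intervalIntegrable_exp_neg_mul_div h0 (by positivity)), ← add_assoc]
    refine add_le_add ih ?_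
    have := mul_le_integral_of_antitoneOn (a := (J : ℝ)) (b := ((J + 1 : ℕ) : ℝ)) (by simp)
      ((antitoneOn_exp_neg_mul_div hδ).mono fun x hx ↦ h0.trans_le hx.1)
    refine le_trans (le_of_eq ?_) this
    push_cast
    ring

theorem sum_Ioc_one_div_sub_le {n T : ℕ} (hT : n ≤ T) :
    ∑ j ∈ Finset.Ioc n T, (1 / ((j : ℝ) - 1) - 1 / j) ≤ 1 / n := by
  have : ∑ j ∈ Finset.Ioc n T, (1 / ((j : ℝ) - 1) - 1 / j) = 1 / n - 1 / T := by
    induction T, hT using Nat.le_induction with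
    | base => simp
    | succ T hT ih =>
      rw [Finset.sum_Ioc_succ_top (by omega), ih]
      push_cast
      ring
  rw [this]
  have : (0 : ℝ) ≤ 1 / T := by positivity
  linarith

theorem log_factorial_eq_sum_primesLE (n : ℕ) :
    log (n ! : ℝ) = ∑ r ∈ n.primesLE, ((n !).factorization r : ℝ) * log r := by
  rw [log_nat_eq_sum_factorization, Finsupp.sum, Nat.support_factorization]
  refine Finset.sum_congr ?_ fun _ _ ↦ rfl
  ext r
  simp only [Nat.mem_primeFactors, Nat.mem_primesLE]
  constructor
  · rintro ⟨h1, h2, -⟩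
    exact ⟨(h1.dvd_factorial).1 h2, h1⟩
  · rintro ⟨h1, h2⟩
    exact ⟨h2, (h2.dvd_factorial).2 h1, n.factorial_ne_zero⟩

theorem mul_log_succ_sub_le_log_factorial (n : ℕ) : n * (log (n + 1) - 1) ≤ log (n ! : ℝ) := by
  induction n with
  | zero => simp
  | succ k ih =>
    rw [Nat.factorial_succ, Nat.cast_mul, log_mul (by positivity) (by positivity)]
    push_cast
    have h1 : log ((k : ℝ) + 1 + 1) - log (k + 1) ≤ 1 / (k + 1) := by
      rw [← log_div (by positivity) (by positivity)]
      refine (log_le_sub_one_of_pos (by positivity)).trans_eq ?_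
      field_simp
      ring
    have h2 : ((k : ℝ) + 1) * (log ((k : ℝ) + 1 + 1) - log (k + 1)) ≤ 1 := by
      calc ((k : ℝ) + 1) * (log ((k : ℝ) + 1 + 1) - log (k + 1))
          ≤ ((k : ℝ) + 1) * (1 / (k + 1)) := by gcongr
        _ = 1 := by field_simp
    linarith

theorem log_factorial_le {n : ℕ} (hn : 1 ≤ n) :
    log (n ! : ℝ) ≤ n * log n - n + 1 + log n := by
  induction n, hn using Nat.le_induction with
  | base => simp
  | succ k hk ih =>
    have hk' : (0 : ℝ) < k := by exact_mod_cast hk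
    rw [Nat.factorial_succ, Nat.cast_mul, log_mul (by positivity) (by positivity)]
    push_cast
    have h1 : 1 / ((k : ℝ) + 1) ≤ log ((k : ℝ) + 1) - log k := by
      rw [← log_div (by positivity) (by positivity)]
      refine le_trans (le_of_eq ?_) (one_sub_inv_le_log_of_pos (by positivity))
      field_simp
      ring
    have h2 : 1 ≤ ((k : ℝ) + 1) * (log ((k : ℝ) + 1) - log k) := by
      calc (1 : ℝ) = ((k : ℝ) + 1) * (1 / (k + 1)) := by field_simp
        _ ≤ _ := by gcongr
    linarith

theorem factorization_factorial_le_div {r n : ℕ} (hr : r.Prime) :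
    ((n !).factorization r : ℝ) ≤ n / ((r : ℝ) - 1) := by
  have h1 : (1 : ℝ) < r := by exact_mod_cast hr.one_lt
  rw [le_div_iff₀ (by linarith)]
  have h := Nat.sub_one_mul_factorization_factorial (n := n) hr
  have h2 : (r - 1) * (n !).factorization r ≤ n := h.trans_le (Nat.sub_le _ _)
  have h3 : (((r - 1) * (n !).factorization r : ℕ) : ℝ) ≤ n := by exact_mod_cast h2
  rw [Nat.cast_mul, Nat.cast_sub hr.one_le] at h3
  push_cast at h3
  linarith

theorem log_succ_sub_one_le_sum_primesLE {n : ℕ} (hn : 1 ≤ n) :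
    log (n + 1) - 1 ≤ ∑ r ∈ n.primesLE, log r / ((r : ℝ) - 1) := by
  have hn' : (0 : ℝ) < n := by exact_mod_cast hn
  refine le_of_mul_le_mul_left ((mul_log_succ_sub_le_log_factorial n).trans ?_) hn'
  rw [log_factorial_eq_sum_primesLE, Finset.mul_sum]
  refine Finset.sum_le_sum fun r hr ↦ ?_
  have hr' := Nat.prime_of_mem_primesLE hr
  have := mul_le_mul_of_nonneg_right (factorization_factorial_le_div (n := n) hr')
    (log_natCast_nonneg r)
  refine this.trans_eq ?_
  ring

theorem div_sub_factorization_factorial_sub_one_le_log {r n : ℕ} (hr : r.Prime) :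
    (n / ((r : ℝ) - 1) - (n !).factorization r - 1) ≤ Nat.log r n := by
  have h1 : (1 : ℝ) < r := by exact_mod_cast hr.one_lt
  rcases Nat.eq_zero_or_pos n with rfl | hn
  · simp
  have h := Nat.sub_one_mul_factorization_factorial (n := n) hr
  have hlen : (r.digits n).length = Nat.log r n + 1 := Nat.length_digits r n hr.one_lt hn.ne'
  have hs : (r.digits n).sum ≤ (r.digits n).length * (r - 1) := by
    refine List.sum_le_card_nsmul _ _ fun d hd ↦ ?_
    have := Nat.digits_lt_base hr.one_lt hd
    omega
  have h2 : n ≤ (r - 1) * (n !).factorization r + (Nat.log r n + 1) * (r - 1) := by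
    rw [hlen] at hs
    omega
  have h3 : (n : ℝ) ≤ ((r - 1) * (n !).factorization r + (Nat.log r n + 1) * (r - 1) : ℕ) := by
    exact_mod_cast h2
  push_cast [Nat.cast_sub hr.one_le] at h3
  have h4 : n / ((r : ℝ) - 1) ≤ (n !).factorization r + (Nat.log r n + 1) := by
    rw [div_le_iff₀ (by linarith)]
    linarith
  linarith

theorem div_sub_factorization_factorial_sub_one_le_div {r n : ℕ} (hr : r.Prime) :
    (n / ((r : ℝ) - 1) - (n !).factorization r - 1) ≤ n / (r * ((r : ℝ) - 1)) := by
  have h1 : (1 : ℝ) < r := by exact_mod_cast hr.one_lt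
  have hdvd : r ^ (n / r) ∣ n ! := by
    have h2 : r ^ (n / r) ∣ (r * (n / r))! :=
      (hr.pow_dvd_iff_le_factorization (Nat.factorial_ne_zero _)).2 (by
        rw [Nat.factorization_factorial_mul hr]; omega)
    exact h2.trans (Nat.factorial_dvd_factorial (Nat.mul_div_le n r))
  have h2 : n / r ≤ (n !).factorization r :=
    (hr.pow_dvd_iff_le_factorization (Nat.factorial_ne_zero _)).1 hdvd
  have h3 : (n : ℝ) / r - 1 ≤ (n !).factorization r := by
    have h4 : ((n / r : ℕ) : ℝ) ≤ (n !).factorization r := by exact_mod_cast h2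
    have h5 := Nat.sub_one_lt_floor ((n : ℝ) / r)
    rw [Nat.floor_div_eq_div] at h5
    linarith
  have h6 : (n : ℝ) / (r * ((r : ℝ) - 1)) = n / ((r : ℝ) - 1) - n / r := by
    have : (r : ℝ) - 1 ≠ 0 := by linarith
    field_simp
    ring
  linarith

theorem sum_primesLE_eq_sum_Ioc (f : ℕ → ℝ) (n : ℕ) :
    ∑ r ∈ n.primesLE, f r = ∑ j ∈ Finset.Ioc 0 n, if j.Prime then f j else 0 := by
  rw [Nat.primesLE_eq_filter_Ioc_zero, Finset.sum_filter]

theorem sum_primesLE_add_sum_Ioc (f : ℕ → ℝ) {n T : ℕ} (hT : n ≤ T) :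
    ∑ r ∈ n.primesLE, f r + ∑ j ∈ Finset.Ioc n T, (if j.Prime then f j else 0) =
      ∑ r ∈ T.primesLE, f r := by
  rw [sum_primesLE_eq_sum_Ioc, sum_primesLE_eq_sum_Ioc,
    Finset.sum_Ioc_consecutive _ (Nat.zero_le n) hT]

theorem sum_Ioc_log_succ_sub_log {n k : ℕ} (hk : n ≤ k) :
    ∑ j ∈ Finset.Ioc n k, (log ((j : ℝ) + 1) - log j) = log (k + 1) - log (n + 1) := by
  induction k, hk using Nat.le_induction with
  | base => simp
  | succ k hk ih =>
    rw [Finset.sum_Ioc_succ_top (by omega), ih]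
    push_cast
    ring

/-- Lower bound for the tail of the prime zeta function, by comparing `∑ log r / (r - 1)`
with `log`. -/
theorem integral_le_sum_Ioc_prime_rpow {δ : ℝ} (hδ : 0 < δ) {n T : ℕ} (hn : 2 ≤ n) (hT : n ≤ T) :
    ∫ v in log (n + 1)..log (T + 1), exp (-(δ * v)) / v ≤
      ∑ j ∈ Finset.Ioc n T, (if j.Prime then (j : ℝ) ^ (-(1 + δ)) else 0) +
      (∑ r ∈ n.primesLE, log r / ((r : ℝ) - 1) - log n + 1) / log n + 1 / n := by
  have hn' : (2 : ℝ) ≤ n := by exact_mod_cast hn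
  have hL : 0 < log n := log_pos (by linarith)
  set K : ℝ := ∑ r ∈ n.primesLE, log r / ((r : ℝ) - 1) - log n + 1 with hK
  have hK0 : 0 ≤ K := by
    have h1 := log_succ_sub_one_le_sum_primesLE (n := n) (by omega)
    have h2 : log (n : ℝ) ≤ log ((n : ℝ) + 1) := log_le_log (by linarith) (by linarith)
    linarith
  set a : ℕ → ℝ := fun j ↦ if j.Prime then log j / ((j : ℝ) - 1) else 0 with ha
  set g : ℕ → ℝ := fun j ↦ exp (-(δ * log j)) / log j with hg
  have hlog : ∀ j : ℕ, n ≤ j → 0 < log (j : ℝ) := fun j hj ↦ by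
    have : (n : ℝ) ≤ j := by exact_mod_cast hj
    exact log_pos (by linarith)
  have hganti : AntitoneOn g (Set.Ici n) := by
    intro x hx y hy hxy
    have hx' := hlog x hx
    refine antitoneOn_exp_neg_mul_div hδ.le hx' (hlog y hy) ?_
    have : (n : ℝ) ≤ x := by exact_mod_cast hx
    exact log_le_log (by linarith) (by exact_mod_cast hxy)
  have hpartial : ∀ k, n ≤ k →
      -K ≤ ∑ j ∈ Finset.Ioc n k, (a j - (log ((j : ℝ) + 1) - log j)) := by
    intro k hk
    rw [Finset.sum_sub_distrib, sum_Ioc_log_succ_sub_log hk]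
    have h1 := sum_primesLE_add_sum_Ioc (fun r ↦ log r / ((r : ℝ) - 1)) hk
    have h2 := log_succ_sub_one_le_sum_primesLE (n := k) (by omega)
    have h3 : log (n : ℝ) ≤ log ((n : ℝ) + 1) := log_le_log (by linarith) (by linarith)
    simp only [ha]
    linarith
  have hAbel := neg_mul_le_sum_Ioc_mul_of_antitoneOn hganti hpartial hT
    (div_nonneg (exp_pos _).le (hlog T hT).le)
  have hint := integral_le_sum_Ioc_log_succ_sub_log hδ.le (n := n) (T := T) (by omega) hT
  have hterm : ∀ j ∈ Finset.Ioc n T, a j * g j ≤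
      (if j.Prime then (j : ℝ) ^ (-(1 + δ)) else 0) + (1 / ((j : ℝ) - 1) - 1 / j) := by
    intro j hj
    have hnj := (Finset.mem_Ioc.1 hj).1
    have hlj := hlog j hnj.le
    have hj2 : (2 : ℝ) < j := hn'.trans_lt (by exact_mod_cast hnj)
    have hj1 : 0 < (j : ℝ) - 1 := by linarith
    have hj0 : 0 < (j : ℝ) := by linarith
    have hdiff : 0 ≤ 1 / ((j : ℝ) - 1) - 1 / j := by
      rw [sub_nonneg]
      gcongr
      linarith
    simp only [ha, hg]
    split_ifs
    · have h1 : (j : ℝ) ^ (-(1 + δ)) = exp (-(δ * log j)) * (1 / j) := by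
        rw [show -(1 + δ) = -δ - 1 by ring, rpow_sub_one hj0.ne', rpow_def_of_pos hj0]
        rw [show log (j : ℝ) * -δ = -(δ * log j) by ring]
        ring
      have h2 : log (j : ℝ) / (j - 1) * (exp (-(δ * log j)) / log j) =
          exp (-(δ * log j)) * (1 / (j - 1)) := by
        field_simp
      have h3 : exp (-(δ * log j)) ≤ 1 := exp_le_one_iff.2 (by nlinarith)
      rw [h1, h2]
      nlinarith [mul_le_mul_of_nonneg_right h3 hdiff]
    · simpa using hdiff
  have hsum := Finset.sum_le_sum hterm
  rw [Finset.sum_add_distrib] at hsum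
  have htail := sum_Ioc_one_div_sub_le hT
  have hgn : K * g n ≤ K / log n := by
    rw [div_eq_mul_one_div]
    refine mul_le_mul_of_nonneg_left ?_ hK0
    exact div_le_div_of_nonneg_right (exp_le_one_iff.2 (by nlinarith)) hL.le
  simp only [sub_mul, Finset.sum_sub_distrib] at hAbel hint
  simp only [hg] at hAbel hsum hgn
  linarith

theorem neg_log_le_sum_exp_neg_mul_div {δ ε : ℝ} (hδ : 0 < δ) (hε : 0 < ε) (A : ℕ) :
    ∃ J, A ≤ J ∧ -log δ - harmonic A - ε ≤ ∑ k ∈ Finset.Ioc A J, exp (-(δ * k)) / k := by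
  have hx : |exp (-δ)| < 1 := by
    rw [abs_of_pos (exp_pos _)]
    exact exp_lt_one_iff.2 (by linarith)
  have h := (Real.hasSum_pow_div_log_of_abs_lt_one hx).tendsto_sum_nat
  have hlog : -log δ ≤ -log (1 - exp (-δ)) := by
    have h1 : 0 < 1 - exp (-δ) := by
      have := exp_lt_one_iff.2 (show -δ < 0 by linarith)
      linarith
    have h2 := log_le_log h1 (show 1 - exp (-δ) ≤ δ by linarith [add_one_le_exp (-δ)])
    linarith
  have hev := h.eventually (lt_mem_nhds (show -log (1 - exp (-δ)) - ε < _ by linarith))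
  obtain ⟨J, hJ, hAJ⟩ := (hev.and (eventually_ge_atTop A)).exists
  refine ⟨J, hAJ, ?_⟩
  have hterm : ∀ M : ℕ, ∑ i ∈ Finset.range M, exp (-δ) ^ (i + 1) / ((i : ℝ) + 1) =
      ∑ k ∈ Finset.Ioc 0 M, exp (-(δ * k)) / k := by
    intro M
    induction M with
    | zero => simp
    | succ M ih =>
      rw [Finset.sum_range_succ, ih, Finset.sum_Ioc_succ_top (by omega), ← exp_nat_mul]
      push_cast
      congr 3
      ring
  have hA : ∑ k ∈ Finset.Ioc 0 A, exp (-(δ * k)) / k ≤ harmonic A := by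
    rw [← hterm, harmonic]
    push_cast
    refine Finset.sum_le_sum fun i _ ↦ ?_
    rw [inv_eq_one_div]
    gcongr
    exact pow_le_one₀ (exp_pos _).le (exp_le_one_iff.2 (by linarith))
  rw [hterm, ← Finset.sum_Ioc_consecutive _ (Nat.zero_le A) hAJ] at hJ
  linarith

theorem sum_primesLE_neg_log_one_sub_rpow_add_le {δ : ℝ} (hδ : 0 < δ) {n A : ℕ} (hn : 2 ≤ n)
    (hA : log ((n : ℝ) + 1) ≤ A) :
    ∑ r ∈ n.primesLE, -log (1 - (r : ℝ) ^ (-(1 + δ))) +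
        exp (-(δ * A)) * (log A - log (log (n + 1))) ≤
      harmonic A + (∑ r ∈ n.primesLE, log r / ((r : ℝ) - 1) - log n + 1) / log n + 1 / n +
        log (1 + δ) := by
  have hn' : (2 : ℝ) ≤ n := by exact_mod_cast hn
  refine le_of_forall_pos_le_add fun ε hε ↦ ?_
  obtain ⟨J, hAJ, hJ⟩ := neg_log_le_sum_exp_neg_mul_div hδ hε A
  obtain ⟨T, hT⟩ := exists_nat_ge (max (n : ℝ) (exp J))
  have hnT : n ≤ T := by exact_mod_cast (le_max_left _ _).trans hT
  have hJT : (J : ℝ) ≤ log (T + 1) := by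
    rw [le_log_iff_exp_le (by positivity)]
    linarith [(le_max_right (n : ℝ) (exp J)).trans hT]
  have ha : 0 < log ((n : ℝ) + 1) := log_pos (by linarith)
  have hJ0 : (0 : ℝ) < J := ha.trans_le (hA.trans (by exact_mod_cast hAJ))
  have h1 := add_sum_Ioc_le_integral hδ.le ha hA hAJ
  have h2 := integral_le_sum_Ioc_prime_rpow hδ hn hnT
  rw [← intervalIntegral.integral_add_adjacent_intervals
    (intervalIntegrable_exp_neg_mul_div ha hJ0)
    (intervalIntegrable_exp_neg_mul_div hJ0 (hJ0.trans_le hJT))] at h2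
  have h3 : 0 ≤ ∫ v in (J : ℝ)..log (T + 1), exp (-(δ * v)) / v :=
    intervalIntegral.integral_nonneg hJT fun v hv ↦
      div_nonneg (exp_pos _).le (hJ0.le.trans hv.1)
  have h4 := sum_primesLE_neg_log_one_sub_rpow_le hδ T
  rw [← sum_primesLE_add_sum_Ioc _ hnT] at h4
  have h5 : ∑ j ∈ Finset.Ioc n T, (if j.Prime then (j : ℝ) ^ (-(1 + δ)) else 0) ≤
      ∑ j ∈ Finset.Ioc n T, (if j.Prime then -log (1 - (j : ℝ) ^ (-(1 + δ))) else 0) := by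
    refine Finset.sum_le_sum fun j _ ↦ ?_
    split_ifs with hj
    · have h6 := natCast_rpow_neg_lt_one (s := 1 + δ) (by linarith) hj
      have h7 := log_le_sub_one_of_pos (show 0 < 1 - (j : ℝ) ^ (-(1 + δ)) by linarith)
      linarith
    · exact le_rfl
  have h6 : log (1 + 1 / δ) = log (1 + δ) - log δ := by
    rw [← log_div (by positivity) hδ.ne']
    congr 1
    field_simp
    ring
  linarith

/-- An explicit form of the upper bound in Mertens' third theorem. -/
theorem sum_primesLE_neg_log_one_sub_le {n : ℕ} (hn : 2 ≤ n) :
    ∑ r ∈ n.primesLE, -log (1 - 1 / (r : ℝ)) ≤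
      eulerMascheroniConstant + log (log (n + 1)) +
      (∑ r ∈ n.primesLE, log r / ((r : ℝ) - 1) - log n + 1) / log n + 1 / n := by
  have key : ∀ A : ℕ, log ((n : ℝ) + 1) ≤ A → ∑ r ∈ n.primesLE, -log (1 - 1 / (r : ℝ)) ≤
      (harmonic A - log A) + log (log (n + 1)) +
      (∑ r ∈ n.primesLE, log r / ((r : ℝ) - 1) - log n + 1) / log n + 1 / n := by
    intro A hA
    have hlhs : Tendsto (fun δ : ℝ ↦ ∑ r ∈ n.primesLE, -log (1 - (r : ℝ) ^ (-(1 + δ))) +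
        exp (-(δ * A)) * (log A - log (log (n + 1)))) (𝓝[>] 0)
        (𝓝 (∑ r ∈ n.primesLE, -log (1 - (r : ℝ) ^ (-(1 + (0 : ℝ)))) +
          exp (-(0 * A)) * (log A - log (log (n + 1))))) := by
      refine Tendsto.mono_left ?_ nhdsWithin_le_nhds
      refine Tendsto.add (tendsto_finsetSum _ fun r hr ↦ ?_) ?_
      · have hp := Nat.prime_of_mem_primesLE hr
        have h1 := natCast_rpow_neg_lt_one (s := 1 + 0) (by norm_num) hp
        have hr0 : (r : ℝ) ≠ 0 := by exact_mod_cast hp.ne_zero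
        refine ContinuousAt.tendsto (x := (0 : ℝ)) ?_
        refine (ContinuousAt.log ?_ (by linarith)).neg
        refine continuousAt_const.sub ?_
        exact ContinuousAt.rpow continuousAt_const (by fun_prop) (Or.inl hr0)
      · exact ContinuousAt.tendsto (x := (0 : ℝ)) (by fun_prop)
    have hrhs : Tendsto (fun δ : ℝ ↦ harmonic A +
        (∑ r ∈ n.primesLE, log r / ((r : ℝ) - 1) - log n + 1) / log n + 1 / n + log (1 + δ))
        (𝓝[>] 0) (𝓝 (harmonic A +
        (∑ r ∈ n.primesLE, log r / ((r : ℝ) - 1) - log n + 1) / log n + 1 / n +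
          log (1 + 0))) := by
      refine Tendsto.mono_left ?_ nhdsWithin_le_nhds
      refine Tendsto.const_add _ ?_
      exact ContinuousAt.tendsto (x := (0 : ℝ))
        (ContinuousAt.log (by fun_prop) (by norm_num))
    have h := le_of_tendsto_of_tendsto hlhs hrhs
      (eventually_nhdsWithin_of_forall fun δ hδ ↦
        sum_primesLE_neg_log_one_sub_rpow_add_le hδ hn hA)
    simp only [add_zero, zero_mul, neg_zero, exp_zero, one_mul, log_one, rpow_neg_one,
      inv_eq_one_div] at h
    linarith
  have hlim := ((tendsto_eulerMascheroniSeq'.add_const (log (log ((n : ℝ) + 1)))).add_const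
    ((∑ r ∈ n.primesLE, log r / ((r : ℝ) - 1) - log n + 1) / log n)).add_const (1 / (n : ℝ))
  refine ge_of_tendsto hlim ?_
  have hev := (tendsto_natCast_atTop_atTop (R := ℝ)).eventually_ge_atTop (log ((n : ℝ) + 1))
  filter_upwards [hev, eventually_ge_atTop 1] with A hA hA1
  rw [eulerMascheroniSeq', if_neg (by omega)]
  exact key A hA

theorem log_div_mul_sub_one_le_sub {j : ℕ} (hj : 64 < j) :
    log j / (j * ((j : ℝ) - 1)) ≤
      (log ((j : ℝ) - 1) + 1.02) / ((j : ℝ) - 1) - (log j + 1.02) / j := by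
  have hj' : (65 : ℝ) ≤ j := by exact_mod_cast hj
  have h0 : (0 : ℝ) < j := by linarith
  have h1 : 0 < (j : ℝ) - 1 := by linarith
  have h2 : log (j : ℝ) - log (j - 1) ≤ 1 / ((j : ℝ) - 1) := by
    rw [← log_div h0.ne' h1.ne']
    refine (log_le_sub_one_of_pos (by positivity)).trans_eq ?_
    field_simp
    ring
  have h3 : (j : ℝ) * (log (j : ℝ) - log (j - 1)) ≤ 1.02 := by
    calc (j : ℝ) * (log (j : ℝ) - log (j - 1)) ≤ j * (1 / ((j : ℝ) - 1)) := by gcongr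
      _ ≤ 1.02 := by
        rw [mul_one_div, div_le_iff₀ h1]
        linarith
  rw [div_sub_div _ _ h1.ne' h0.ne', mul_comm (j : ℝ) ((j : ℝ) - 1)]
  gcongr
  linarith

theorem sum_Ioc_log_div_mul_sub_one_le {n : ℕ} (hn : 64 ≤ n) :
    ∑ j ∈ Finset.Ioc 64 n, log j / (j * ((j : ℝ) - 1)) ≤ 0.081 := by
  have h : ∑ j ∈ Finset.Ioc 64 n, log j / (j * ((j : ℝ) - 1)) ≤
      (log 64 + 1.02) / 64 - (log n + 1.02) / n := by
    induction n, hn using Nat.le_induction with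
    | base => simp
    | succ n hn ih =>
      rw [Finset.sum_Ioc_succ_top (by omega)]
      have := log_div_mul_sub_one_le_sub (j := n + 1) (by omega)
      push_cast at this ⊢
      rw [add_sub_cancel_right] at this ⊢
      linarith
  have h64 : log (64 : ℝ) = 6 * log 2 := by
    rw [show (64 : ℝ) = 2 ^ 6 by norm_num, log_pow]
    norm_num
  have h1 : 0 ≤ (log n + 1.02) / n :=
    div_nonneg (add_nonneg (log_natCast_nonneg n) (by norm_num)) (by positivity)
  have h2 := log_two_lt_d9
  rw [h64] at h
  linarith

/-- The excess of `n ∑ log r / (r - 1)` over `θ(n) + log n!`. -/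
theorem sum_primesLE_log_mul_sub_factorization_le {n : ℕ} (hn : 64 ≤ n) :
    ∑ r ∈ n.primesLE, log r * (n / ((r : ℝ) - 1) - (n !).factorization r - 1) ≤
      18 * log n + 0.081 * n := by
  rw [← sum_primesLE_add_sum_Ioc _ hn]
  refine add_le_add ?_ ?_
  · have hcard : Finset.card (Nat.primesLE 64) = 18 := by decide +kernel
    have : ∀ r ∈ Nat.primesLE 64,
        log r * (n / ((r : ℝ) - 1) - (n !).factorization r - 1) ≤ log n := by
      intro r hr
      have hp := Nat.prime_of_mem_primesLE hr
      have h1 := mul_le_mul_of_nonneg_left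
        (div_sub_factorization_factorial_sub_one_le_log (n := n) hp) (log_natCast_nonneg r)
      refine h1.trans ?_
      rw [mul_comm, ← log_pow]
      refine log_le_log (by have := hp.pos; positivity) ?_
      exact_mod_cast Nat.pow_log_le_self r (by omega)
    refine (Finset.sum_le_card_nsmul _ _ _ this).trans_eq ?_
    rw [hcard]
    simp
  · have h := mul_le_mul_of_nonneg_right (sum_Ioc_log_div_mul_sub_one_le hn)
      (Nat.cast_nonneg (α := ℝ) n)
    refine le_trans ?_ h
    rw [Finset.sum_mul]
    refine Finset.sum_le_sum fun j hj ↦ ?_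
    have hj64 : (64 : ℝ) < j := by exact_mod_cast (Finset.mem_Ioc.1 hj).1
    have hj1 : 0 < (j : ℝ) - 1 := by linarith
    split_ifs with hp
    · refine (mul_le_mul_of_nonneg_left
        (div_sub_factorization_factorial_sub_one_le_div (n := n) hp)
        (log_natCast_nonneg j)).trans_eq ?_
      ring
    · have := log_natCast_nonneg j
      positivity

theorem mul_sum_primesLE_sub_theta_le {n : ℕ} (hn : 64 ≤ n) :
    n * ∑ r ∈ n.primesLE, log r / ((r : ℝ) - 1) - θ n ≤
      n * log n - n + 1 + 19 * log n + 0.081 * n := by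
  have h1 := sum_primesLE_log_mul_sub_factorization_le hn
  have h2 := log_factorial_le (n := n) (by omega)
  rw [log_factorial_eq_sum_primesLE] at h2
  have h3 : n * ∑ r ∈ n.primesLE, log r / ((r : ℝ) - 1) - θ n =
      ∑ r ∈ n.primesLE, log r * (n / ((r : ℝ) - 1) - (n !).factorization r - 1) +
      ∑ r ∈ n.primesLE, ((n !).factorization r : ℝ) * log r := by
    rw [theta_eq_sum_primesLE_log, Finset.mul_sum, ← Finset.sum_sub_distrib,
      ← Finset.sum_add_distrib]
    refine Finset.sum_congr rfl fun r _ ↦ ?_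
    ring
  linarith

theorem log_div_totient_le_log_log {N n : ℕ} (hN : N ≠ 0) (hn : 2048 ≤ n)
    (h : log N ≤ n + 1) :
    log (N / N.totient) ≤ eulerMascheroniConstant + log (log n) + 1.16 / log n := by
  have hn' : (2048 : ℝ) ≤ n := by exact_mod_cast hn
  have hn0 : (0 : ℝ) < n := by linarith
  have hlog2 := log_two_lt_d9
  have hL : 0 < log (n : ℝ) := log_pos (by linarith)
  have hlogn : log (n : ℝ) ≤ 0.003724 * n := by
    have h1 := log_le_sub_one_of_pos (show (0 : ℝ) < n / 2048 by positivity)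
    rw [log_div hn0.ne' (by norm_num), show (2048 : ℝ) = 2 ^ 11 by norm_num, log_pow] at h1
    norm_num at h1
    linarith
  have hpivot := log_div_totient_le hN (n := n) (by omega)
  have hmertens := sum_primesLE_neg_log_one_sub_le (n := n) (by omega)
  have hM := mul_sum_primesLE_sub_theta_le (n := n) (by omega)
  set M : ℝ := ∑ r ∈ n.primesLE, log r / ((r : ℝ) - 1)
  have hloglog : log (log ((n : ℝ) + 1)) ≤ log (log n) + 1 / (n * log n) := by
    have h1 : log ((n : ℝ) + 1) ≤ log n + 1 / n := by
      have := log_le_sub_one_of_pos (show (0 : ℝ) < (n + 1) / n by positivity)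
      rw [log_div (by positivity) hn0.ne', add_div, div_self hn0.ne'] at this
      linarith
    have h2 : log (log n + 1 / n) ≤ log (log n) + 1 / (n * log n) := by
      have := log_le_sub_one_of_pos (show (0 : ℝ) < (log n + 1 / n) / log n by positivity)
      rw [log_div (by positivity) hL.ne', add_div, div_self hL.ne', div_div] at this
      linarith
    exact (log_le_log (log_pos (by linarith)) h1).trans h2
  have hnum : (M - log n + 1) / log n + 1 / n + (log N - θ n) / (n * log n) + 1 / (n * log n) ≤
      1.16 / log n := by
    have h1 : (M - log n + 1) / log n + 1 / n + (log N - θ n) / (n * log n) + 1 / (n * log n) =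
        (n * M - θ n - n * log n + n + log n + log N + 1) / (n * log n) := by
      field_simp
      ring
    have h2 : 1.16 / log n = 1.16 * n / (n * log n) := by
      field_simp
    rw [h1, h2]
    gcongr
    linarith
  linarith

theorem exp_eulerMascheroniConstant_le : exp eulerMascheroniConstant ≤ 1.796 := by
  have h1 : eulerMascheroniConstant < 0.5851 := by
    refine (eulerMascheroniConstant_lt_eulerMascheroniSeq' 64).trans ?_
    have h64 : log ((64 : ℕ) : ℝ) = 6 * log 2 := by
      rw [show ((64 : ℕ) : ℝ) = 2 ^ 6 by norm_num, log_pow]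
      norm_num
    have hh : (harmonic 64 : ℝ) < 4.7439 := by
      have : harmonic 64 < 47439 / 10000 := by
        norm_num [harmonic, Finset.sum_range_succ]
      refine ((Rat.cast_lt (K := ℝ)).2 this).trans_eq ?_
      norm_num
    rw [eulerMascheroniSeq', if_neg (by norm_num), h64]
    linarith [log_two_gt_d9]
  refine (exp_le_exp.2 h1.le).trans ?_
  refine (exp_bound' (by norm_num) (by norm_num) (n := 6) (by norm_num)).trans ?_
  norm_num [Finset.sum_range_succ, Nat.factorial]

theorem div_totient_le_of_le_log {N n : ℕ} (hN : N ≠ 0) (hn : 2048 ≤ n) (h : log N ≤ n + 1) :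
    (N / N.totient : ℝ) ≤ 1.8 * log n + 2.25 := by
  have hn' : (2048 : ℝ) ≤ n := by exact_mod_cast hn
  have hL : 7.62 ≤ log (n : ℝ) := by
    have h1 := log_le_log (by norm_num) hn'
    rw [show (2048 : ℝ) = 2 ^ 11 by norm_num, log_pow] at h1
    norm_num at h1
    linarith [log_two_gt_d9]
  have hpos : (0 : ℝ) < N / N.totient := by
    have := Nat.totient_pos.2 (Nat.pos_of_ne_zero hN)
    positivity
  have h1 := log_div_totient_le_log_log hN hn h
  set L := log (n : ℝ) with hLdef
  have hL0 : 0 < L := by linarith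
  rw [← exp_log hpos]
  refine (exp_le_exp.2 h1).trans ?_
  rw [exp_add, exp_add, exp_log hL0]
  have hx : 1.16 / L ≤ 0.1523 := by
    rw [div_le_iff₀ hL0]
    linarith
  have hx0 : 0 ≤ 1.16 / L := by positivity
  have h2 : exp (1.16 / L) ≤ 1 + 1.16 / L + 0.54 * (1.16 / L) ^ 2 := by
    refine (exp_bound' hx0 (by linarith) (n := 3) (by norm_num)).trans ?_
    norm_num [Finset.sum_range_succ, Nat.factorial]
    nlinarith [mul_le_mul_of_nonneg_left hx (sq_nonneg (1.16 / L))]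
  have h3 : L * exp (1.16 / L) ≤ L + 1.256 := by
    calc L * exp (1.16 / L) ≤ L * (1 + 1.16 / L + 0.54 * (1.16 / L) ^ 2) := by gcongr
      _ = L + 1.16 + 0.54 * 1.16 * (1.16 / L) := by field_simp
      _ ≤ L + 1.256 := by linarith
  calc exp eulerMascheroniConstant * L * exp (1.16 / L)
      = exp eulerMascheroniConstant * (L * exp (1.16 / L)) := by ring
    _ ≤ 1.796 * (L + 1.256) := by
      gcongr
      exact exp_eulerMascheroniConstant_le
    _ ≤ 1.8 * L + 2.25 := by linarith

theorem le_theta_of_pow_le_prod {m n : ℕ}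
    (h : 27183 ^ m ≤ 10000 ^ m * ∏ r ∈ n.primesLE, r) : (m : ℝ) ≤ θ n := by
  have hpos : (0 : ℝ) < ∏ r ∈ n.primesLE, (r : ℝ) :=
    Finset.prod_pos fun r hr ↦ by exact_mod_cast (Nat.prime_of_mem_primesLE hr).pos
  rw [theta_eq_sum_primesLE_log, ← log_prod fun r hr ↦ by
    exact_mod_cast (Nat.prime_of_mem_primesLE hr).ne_zero, le_log_iff_exp_le hpos]
  have h1 : (27183 : ℝ) ^ m ≤ 10000 ^ m * ∏ r ∈ n.primesLE, (r : ℝ) := by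
    rw [← Nat.cast_prod]
    exact_mod_cast h
  calc exp (m : ℝ) = exp 1 ^ m := by rw [← exp_nat_mul, mul_one]
    _ ≤ (27183 / 10000) ^ m := by
      gcongr
      linarith [exp_one_lt_d9]
    _ ≤ ∏ r ∈ n.primesLE, (r : ℝ) := by
      rw [div_pow, div_le_iff₀ (by positivity)]
      linarith

theorem div_totient_le_of_mem_dyadic {N n j c : ℕ} {X : ℝ} (hN : N ≠ 0) (hn : 2 ≤ n)
    (hX : log N ≤ X) (hX1 : 2 ^ j ≤ X) (hX2 : X ≤ 2 ^ (j + 1))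
    (hprod : 27183 ^ 2 ^ (j + 1) ≤ 10000 ^ 2 ^ (j + 1) * ∏ r ∈ n.primesLE, r)
    (hratio : 100 * ∏ r ∈ n.primesLE, r ≤ c * ∏ r ∈ n.primesLE, (r - 1))
    (hc : (c : ℝ) / 100 ≤ 1.8 * (j * 0.693) + 2.25) :
    (N / N.totient : ℝ) ≤ 1.8 * log X + 2.25 := by
  have hθ := le_theta_of_pow_le_prod hprod
  push_cast at hθ
  have h1 := div_totient_le_of_log_le_theta hN hn (by linarith)
  have hcast : ((∏ r ∈ n.primesLE, (r - 1) : ℕ) : ℝ) = ∏ r ∈ n.primesLE, ((r : ℝ) - 1) := by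
    rw [Nat.cast_prod]
    refine Finset.prod_congr rfl fun r hr ↦ ?_
    rw [Nat.cast_sub (Nat.prime_of_mem_primesLE hr).one_le, Nat.cast_one]
  have hpos : (0 : ℝ) < ∏ r ∈ n.primesLE, ((r : ℝ) - 1) := Finset.prod_pos fun r hr ↦ by
    have : (1 : ℝ) < r := by exact_mod_cast Nat.one_lt_of_mem_primesLE hr
    linarith
  have h2 : (100 : ℝ) * ∏ r ∈ n.primesLE, (r : ℝ) ≤ c * ∏ r ∈ n.primesLE, ((r : ℝ) - 1) := by
    rw [← hcast, ← Nat.cast_prod]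
    exact_mod_cast hratio
  have h3 : (∏ r ∈ n.primesLE, (r : ℝ)) / ∏ r ∈ n.primesLE, ((r : ℝ) - 1) ≤ c / 100 := by
    rw [div_le_div_iff₀ hpos (by norm_num)]
    linarith
  have h4 : (j : ℝ) * 0.693 ≤ log X := by
    have h5 := log_le_log (by positivity) hX1
    rw [log_pow] at h5
    have : (j : ℝ) * 0.693 ≤ j * log 2 := by
      gcongr
      linarith [log_two_gt_d9]
    linarith
  linarith

/-- If `log N ≤ X` with `X ≥ 8` then `N / φ(N) ≤ 1.8 log X + 2.25`. -/
theorem div_totient_le_mul_log_add {N : ℕ} {X : ℝ} (hN : N ≠ 0) (hX : log N ≤ X) (h8 : 8 ≤ X) :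
    (N / N.totient : ℝ) ≤ 1.8 * log X + 2.25 := by
  rcases le_or_gt 2048 X with h | h
  · have hfloor : (⌊X⌋₊ : ℝ) ≤ X := Nat.floor_le (by linarith)
    have h1 : 2048 ≤ ⌊X⌋₊ := Nat.le_floor (by exact_mod_cast h)
    have h2 := div_totient_le_of_le_log hN h1 (hX.trans (Nat.lt_floor_add_one X).le)
    have h3 : log (⌊X⌋₊ : ℝ) ≤ log X := log_le_log (by
      have : (2048 : ℝ) ≤ ⌊X⌋₊ := by exact_mod_cast h1
      linarith) hfloor
    linarith
  rcases le_or_gt X 16 with h16 | h16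
  · refine div_totient_le_of_mem_dyadic (n := 19) (j := 3) (c := 585) hN (by norm_num) hX
      (by norm_num; linarith) (by norm_num; linarith) ?_ ?_ (by norm_num) <;>
    rw [Nat.primesLE_eq_filter_gcd (by norm_num)] <;> decide +kernel
  rcases le_or_gt X 32 with h32 | h32
  · refine div_totient_le_of_mem_dyadic (n := 41) (j := 4) (c := 690) hN (by norm_num) hX
      (by norm_num; linarith) (by norm_num; linarith) ?_ ?_ (by norm_num) <;>
    rw [Nat.primesLE_eq_filter_gcd (by norm_num)] <;> decide +kernel
  rcases le_or_gt X 64 with h64 | h64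
  · refine div_totient_le_of_mem_dyadic (n := 73) (j := 5) (c := 800) hN (by norm_num) hX
      (by norm_num; linarith) (by norm_num; linarith) ?_ ?_ (by norm_num) <;>
    rw [Nat.primesLE_eq_filter_gcd (by norm_num)] <;> decide +kernel
  rcases le_or_gt X 128 with h128 | h128
  · refine div_totient_le_of_mem_dyadic (n := 149) (j := 6) (c := 910) hN (by norm_num) hX
      (by norm_num; linarith) (by norm_num; linarith) ?_ ?_ (by norm_num) <;>
    rw [Nat.primesLE_eq_filter_gcd (by norm_num)] <;> decide +kernel
  rcases le_or_gt X 256 with h256 | h256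
  · refine div_totient_le_of_mem_dyadic (n := 277) (j := 7) (c := 1020) hN (by norm_num) hX
      (by norm_num; linarith) (by norm_num; linarith) ?_ ?_ (by norm_num) <;>
    rw [Nat.primesLE_eq_filter_gcd (by norm_num)] <;> decide +kernel
  rcases le_or_gt X 512 with h512 | h512
  · refine div_totient_le_of_mem_dyadic (n := 547) (j := 8) (c := 1130) hN (by norm_num) hX
      (by norm_num; linarith) (by norm_num; linarith) ?_ ?_ (by norm_num) <;>
    rw [Nat.primesLE_eq_filter_gcd (by norm_num)] <;> decide +kernel
  rcases le_or_gt X 1024 with h1024 | h1024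
  · refine div_totient_le_of_mem_dyadic (n := 1061) (j := 9) (c := 1250) hN (by norm_num) hX
      (by norm_num; linarith) (by norm_num; linarith) ?_ ?_ (by norm_num) <;>
    rw [Nat.primesLE_eq_filter_gcd (by norm_num)] <;> decide +kernel
  refine div_totient_le_of_mem_dyadic (n := 2111) (j := 10) (c := 1370) hN (by norm_num) hX
    (by norm_num; linarith) (by norm_num; linarith) ?_ ?_ (by norm_num) <;>
  rw [Nat.primesLE_eq_filter_gcd (by norm_num)] <;> decide +kernel

theorem log_five_gt : 1.58 < log 5 := by
  have h : log ((2 : ℝ) ^ 16) < log ((5 : ℝ) ^ 7) := log_lt_log (by norm_num) (by norm_num)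
  rw [log_pow, log_pow] at h
  norm_num at h
  linarith [log_two_gt_d9]

theorem log_seven_gt : 1.94 < log 7 := by
  have h : log ((2 : ℝ) ^ 14) < log ((7 : ℝ) ^ 5) := log_lt_log (by norm_num) (by norm_num)
  rw [log_pow, log_pow] at h
  norm_num at h
  linarith [log_two_gt_d9]

/-- Let `p ≥ 5` be prime, `q` a power of `p`, and `u ≥ 1`. Then
`(q^{pu} - 1)/φ(q^{pu} - 1) < 3.6 log q + 1.8 log u` (natural logarithm). -/
theorem stmt_19 (p t q u : ℕ) (hp : p.Prime) (hp5 : 5 ≤ p) (ht : 1 ≤ t) (hq : q = p ^ t)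
    (hu : 1 ≤ u) :
    ((q ^ (p * u) - 1 : ℕ) : ℝ) / ((q ^ (p * u) - 1).totient : ℝ) <
      3.6 * Real.log q + 1.8 * Real.log u := by
  have hpq : p ≤ q := hq ▸ Nat.le_self_pow (by omega) p
  have hp' : (5 : ℝ) ≤ p := by exact_mod_cast hp5
  have hpq' : (p : ℝ) ≤ q := by exact_mod_cast hpq
  have hu' : (1 : ℝ) ≤ u := by exact_mod_cast hu
  have hm : p * u ≠ 0 := by positivity
  have hqm : 1 < q ^ (p * u) := Nat.one_lt_pow hm (by omega)
  set N := q ^ (p * u) - 1 with hNdef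
  have hN : N ≠ 0 := by omega
  have hNq : (N : ℝ) ≤ (q : ℝ) ^ (p * u) := by
    exact_mod_cast (Nat.sub_le _ _ : N ≤ q ^ (p * u))
  have hN0 : (0 : ℝ) < N := by exact_mod_cast Nat.pos_of_ne_zero hN
  set l := Real.log q with hl
  have hpl : Real.log p ≤ l := log_le_log (by linarith) hpq'
  have hl5 : Real.log 5 ≤ l := log_le_log (by norm_num) (by linarith)
  have h5 := log_five_gt
  have hl0 : 0 < l := by linarith
  set X : ℝ := p * u * l with hXdef
  have hNX : Real.log N ≤ X := by
    refine (log_le_log hN0 hNq).trans_eq ?_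
    rw [log_pow]
    push_cast
    ring
  have hlogX : Real.log X = Real.log p + Real.log u + Real.log l := by
    rw [hXdef, log_mul (by positivity) hl0.ne', log_mul (by positivity) (by positivity)]
  have hlu : 0 ≤ Real.log u := log_nonneg hu'
  have hpX : p * l ≤ X := by
    rw [hXdef, mul_assoc]
    gcongr
    exact le_mul_of_one_le_left hl0.le hu'
  rcases hp5.eq_or_lt with h | h
  · have hcop : Nat.Coprime 5 N := by
      have h5q : 5 ∣ q ^ (p * u) := by
        rw [hq, ← h]
        exact dvd_pow (dvd_pow_self 5 (by omega)) (by omega)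
      refine (Nat.Prime.coprime_iff_not_dvd (by norm_num)).2 fun hdvd ↦ ?_
      omega
    have hφ : (5 * N).totient = 4 * N.totient := by
      rw [Nat.totient_mul hcop, Nat.totient_prime (by norm_num)]
    have h5X : 5 * l ≤ X := by
      rw [← h] at hpX
      exact_mod_cast hpX
    have hlog5N : Real.log ((5 * N : ℕ) : ℝ) ≤ X + Real.log 5 := by
      push_cast
      rw [log_mul (by norm_num) hN0.ne']
      linarith
    have h1 := div_totient_le_mul_log_add (by omega) hlog5N (by linarith)
    have h2 : ((5 * N : ℕ) : ℝ) / ((5 * N).totient : ℝ) = 5 / 4 * (N / N.totient) := by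
      rw [hφ]
      push_cast
      ring
    have hX0 : 0 < X := by linarith
    have h3 : Real.log (X + Real.log 5) ≤ Real.log X + 0.2 := by
      have h4 : X + Real.log 5 ≤ X * exp 0.2 := by
        nlinarith [add_one_le_exp (0.2 : ℝ)]
      have h5 := log_le_log (by linarith) h4
      rwa [log_mul hX0.ne' (exp_pos _).ne', log_exp] at h5
    have h6 := log_le_sub_one_of_pos hl0
    rw [h2] at h1
    linarith
  · have h7 : 7 ≤ p := by
      by_contra hlt
      have : p = 6 := by omega
      rw [this] at hp
      exact absurd hp (by norm_num)
    have h7' : (7 : ℝ) ≤ p := by exact_mod_cast h7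
    have hl7 : 1.94 < l := log_seven_gt.trans_le (log_le_log (by norm_num) (by linarith))
    have h1 := div_totient_le_mul_log_add hN hNX (by nlinarith)
    have h2 : Real.log l ≤ l / 1.94 - 1 + 0.6632 := by
      have h3 := log_le_sub_one_of_pos (show 0 < l / 1.94 by positivity)
      rw [log_div hl0.ne' (by norm_num)] at h3
      have h4 := log_le_sub_one_of_pos (show (0 : ℝ) < 1.94 / 2 by norm_num)
      rw [log_div (by norm_num) (by norm_num)] at h4
      linarith [log_two_lt_d9]
    have h3 : l / 1.94 ≤ 0.5155 * l := by
      rw [div_le_iff₀ (by norm_num)]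
      linarith
    linarith
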